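/- Let E ⊆ ℝ² be closed and simply connected with induced path metric d̄, and let T be a simple geodesic triangle in (E,d̄) with vertices x, y, z. Then T is contained in the convex hull (in ℝ²) of the set {x, y, z}. -/

import Mathlib

open Set

noncomputable def pathLength {X : Type*} [PseudoEMetricSpace X] {x y : X} (c : Path x y) : ENNReal :=
  eVariationOn (fun t : unitInterval => c t) Set.univ

noncomputable def pathEDist {X : Type*} [PseudoEMetricSpace X] (x y : X) : ENNReal :=
  ⨅ c : Path x y, pathLength c

/-- A unit-speed geodesic segment of the path metric `pathEDist`, parametrized on
`[0, D]`, from `x` to `y`. -/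
def IsGeodesicSegment {X : Type*} [MetricSpace X] (γ : ℝ → X) (D : ℝ) (x y : X) : Prop :=
  γ 0 = x ∧ γ D = y ∧
    ∀ s ∈ Set.Icc 0 D, ∀ t ∈ Set.Icc 0 D, pathEDist (γ s) (γ t) = ENNReal.ofReal |s - t|

/-- A simple closed curve: the image of a topological circle under a continuous
injective map. -/
def IsSimpleClosedCurve {M : Type*} [TopologicalSpace M] (s : Set M) : Prop :=
  ∃ φ : Metric.sphere (0 : EuclideanSpace ℝ (Fin 2)) 1 → M,
    Continuous φ ∧ Function.Injective φ ∧ Set.range φ = s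

/-- A simple geodesic triangle in `(E, d̄)`: three vertices `p`, `q`, `r` of `E`, joined
pairwise by geodesic segments of the induced path metric on `E`, whose union is a
simple closed curve in the ambient space `M`. -/
structure SimpleGeodesicTriangle {M : Type*} [MetricSpace M] (E : Set M) where
  p : E
  q : E
  r : E
  σ : ℝ → E
  τ : ℝ → E
  ρ : ℝ → E
  a : ℝ
  b : ℝ
  c : ℝ
  ha : 0 ≤ a
  hb : 0 ≤ b
  hc : 0 ≤ c
  hσ : IsGeodesicSegment σ a p q
  hτ : IsGeodesicSegment τ b p r
  hρ : IsGeodesicSegment ρ c q r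
  simple : IsSimpleClosedCurve
    ((Subtype.val ∘ σ) '' Set.Icc 0 a ∪ (Subtype.val ∘ τ) '' Set.Icc 0 b ∪
      (Subtype.val ∘ ρ) '' Set.Icc 0 c)

namespace SimpleGeodesicTriangle

variable {M : Type*} [MetricSpace M] {E : Set M} (T : SimpleGeodesicTriangle E)

/-- The image of the triangle in the ambient space. -/
def im : Set M :=
  (Subtype.val ∘ T.σ) '' Set.Icc 0 T.a ∪ (Subtype.val ∘ T.τ) '' Set.Icc 0 T.b ∪
    (Subtype.val ∘ T.ρ) '' Set.Icc 0 T.c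

def edgePQ : Set M := (Subtype.val ∘ T.σ) '' Set.Icc 0 T.a
def edgePR : Set M := (Subtype.val ∘ T.τ) '' Set.Icc 0 T.b
def edgeQR : Set M := (Subtype.val ∘ T.ρ) '' Set.Icc 0 T.c

/-- `A` is an edge of the triangle `T`. -/
def IsEdge (A : Set M) : Prop := A = T.edgePQ ∨ A = T.edgePR ∨ A = T.edgeQR

/-- The (Jordan) interior of the simple closed curve `T`: the points of the bounded
complementary component. -/
def interior : Set M :=
  {w | w ∉ T.im ∧ Bornology.IsBounded (connectedComponentIn T.imᶜ w)}

/-- The (Jordan) exterior of the simple closed curve `T`: the points of the unbounded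
complementary component. -/
def exterior : Set M :=
  {w | w ∉ T.im ∧ ¬ Bornology.IsBounded (connectedComponentIn T.imᶜ w)}

end SimpleGeodesicTriangle

/-- `z ↦ z - w` has a continuous logarithm on `J`. -/
def HasLogAt (J : Set ℂ) (w : ℂ) : Prop :=
  ∃ L : ℂ → ℂ, ContinuousOn L J ∧ ∀ z ∈ J, Complex.exp (L z) = z - w

lemma div_mem_slitPlane_of_notMem_segment {u v z : ℂ} (h : z ∉ segment ℝ u v) :
    (z - u) / (z - v) ∈ Complex.slitPlane := by
  by_contra hq
  apply h
  rw [Complex.mem_slitPlane_iff, not_or, not_lt, not_not] at hq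
  by_cases hzv : z - v = 0
  · rw [sub_eq_zero.1 hzv]; exact right_mem_segment ℝ u v
  set q := (z - u) / (z - v) with hqdef
  have hqr : q = ((q.re : ℝ) : ℂ) := Complex.ext (by simp) (by simp [hq.2])
  have hz : z - u = q * (z - v) := by rw [hqdef]; field_simp
  have h1 : 0 < 1 - q.re := by linarith [hq.1]
  refine ⟨1 / (1 - q.re), -q.re / (1 - q.re), by positivity,
    div_nonneg (by linarith [hq.1]) h1.le, by field_simp; ring, ?_⟩
  have h2 : (1 - (q.re : ℂ)) ≠ 0 := by exact_mod_cast h1.ne'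
  rw [hqr] at hz
  simp only [Complex.real_smul]
  push_cast
  field_simp
  linear_combination -hz

lemma HasLogAt.of_segment_disjoint {J : Set ℂ} {u v : ℂ} (hv : HasLogAt J v)
    (h : Disjoint (segment ℝ u v) J) : HasLogAt J u := by
  obtain ⟨L, hL, hLe⟩ := hv
  have hns : ∀ z ∈ J, z ∉ segment ℝ u v := fun z hz hs => h.le_bot ⟨hs, hz⟩
  have hne : ∀ z ∈ J, z - v ≠ 0 := fun z hz h0 =>
    hns z hz (sub_eq_zero.1 h0 ▸ right_mem_segment ℝ u v)
  refine ⟨fun z => L z + Complex.log ((z - u) / (z - v)), hL.add ?_, fun z hz => ?_⟩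
  · refine ContinuousOn.clog ?_ fun z hz => div_mem_slitPlane_of_notMem_segment (hns z hz)
    exact (by fun_prop : ContinuousOn (fun z : ℂ => z - u) J).div (by fun_prop) hne
  · have hs := Complex.slitPlane_ne_zero (div_mem_slitPlane_of_notMem_segment (hns z hz))
    rw [Complex.exp_add, Complex.exp_log hs, hLe z hz, mul_div_cancel₀ _ (hne z hz)]

lemma hasLogAt_of_forall_norm_lt {J : Set ℂ} {v : ℂ} (h : ∀ z ∈ J, ‖z‖ < ‖v‖) :
    HasLogAt J v := by
  have hs : ∀ z ∈ J, 1 - z / v ∈ Complex.slitPlane := fun z hz => by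
    have hv : 0 < ‖v‖ := (norm_nonneg z).trans_lt (h z hz)
    refine Or.inl ?_
    have : (z / v).re < 1 := (Complex.re_le_norm _).trans_lt (by
      rw [norm_div, div_lt_one hv]; exact h z hz)
    simpa using this
  refine ⟨fun z => Complex.log (-v) + Complex.log (1 - z / v),
    continuousOn_const.add (ContinuousOn.clog (by fun_prop) hs), fun z hz => ?_⟩
  have hv : v ≠ 0 := norm_pos_iff.1 ((norm_nonneg z).trans_lt (h z hz))
  rw [Complex.exp_add, Complex.exp_log (neg_ne_zero.2 hv),
    Complex.exp_log (Complex.slitPlane_ne_zero (hs z hz))]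
  field_simp
  ring

lemma Topology.IsEmbedding.exists_continuousOn_leftInverse {X Y : Type*} [TopologicalSpace X]
    [TopologicalSpace Y] [Nonempty X] {φ : X → Y} (hφ : Topology.IsEmbedding φ) :
    ∃ g : Y → X, ContinuousOn g (range φ) ∧ ∀ x, g (φ x) = x := by
  have hg := Function.leftInverse_invFun hφ.injective
  refine ⟨Function.invFun φ, ?_, hg⟩
  rw [continuousOn_iff_continuous_domRestrict]
  convert hφ.toHomeomorph.symm.continuous using 1
  ext ⟨_, x, rfl⟩
  rw [domRestrict_apply, hg x, eq_comm, Homeomorph.symm_apply_eq]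
  rfl

/-- The standard parametrization of the unit circle on `[0, 1]`. -/
noncomputable def circleLoop (t : unitInterval) :
    Metric.sphere (0 : EuclideanSpace ℝ (Fin 2)) 1 :=
  ⟨!₂[Real.cos (2 * Real.pi * t), Real.sin (2 * Real.pi * t)], by
    simp [EuclideanSpace.norm_eq]⟩

lemma continuous_circleLoop : Continuous circleLoop := by
  unfold circleLoop
  refine Continuous.subtype_mk ?_ _
  refine (PiLp.continuous_toLp 2 _).comp (continuous_pi fun i => ?_)
  fin_cases i <;> simp <;> fun_prop

lemma circleLoop_eq_iff {s t : unitInterval} (h : circleLoop s = circleLoop t) :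
    s = t ∨ (s = 0 ∧ t = 1) ∨ (s = 1 ∧ t = 0) := by
  have h' := congrArg Subtype.val h
  have hc := congrArg (fun x : EuclideanSpace ℝ (Fin 2) => x 0) h'
  have hs := congrArg (fun x : EuclideanSpace ℝ (Fin 2) => x 1) h'
  simp only [circleLoop, PiLp.toLp_apply, Matrix.cons_val_zero, Matrix.cons_val_one] at hc hs
  have : Complex.exp ((2 * Real.pi * s : ℝ) * Complex.I)
      = Complex.exp ((2 * Real.pi * t : ℝ) * Complex.I) := by
    rw [Complex.exp_mul_I, Complex.exp_mul_I, ← Complex.ofReal_cos, ← Complex.ofReal_sin,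
      ← Complex.ofReal_cos, ← Complex.ofReal_sin, hc, hs]
  obtain ⟨n, hn⟩ := Complex.exp_eq_exp_iff_exists_int.1 this
  have hn' : (s : ℝ) = t + n := by
    have := congrArg Complex.im hn
    simp at this
    have hpi := Real.pi_pos
    have h2 : (2 * Real.pi) * (s : ℝ) = (2 * Real.pi) * (t + n) := by linarith
    exact mul_left_cancel₀ (by positivity) h2
  have hs1 := s.2.1; have hs2 := s.2.2; have ht1 := t.2.1; have ht2 := t.2.2
  have hl : (-1 : ℤ) ≤ n := by
    have : (-1 : ℝ) ≤ n := by linarith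
    exact_mod_cast this
  have hu : n ≤ (1 : ℤ) := by
    have : (n : ℝ) ≤ 1 := by linarith
    exact_mod_cast this
  interval_cases n
  · right; left
    constructor <;> ext <;> push_cast at * <;> linarith
  · left; ext; simpa using hn'
  · right; right
    constructor <;> ext <;> push_cast at * <;> linarith

lemma surjective_circleLoop : Function.Surjective circleLoop := by
  intro x
  set z : ℂ := ⟨x.1 0, x.1 1⟩ with hz
  have hx : (x.1 0) ^ 2 + (x.1 1) ^ 2 = 1 := by
    have h1 : ‖x.1‖ = 1 := by simp
    have := EuclideanSpace.real_norm_sq_eq x.1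
    rw [h1] at this
    simpa [Fin.sum_univ_two] using this.symm
  have hn : ‖z‖ = 1 := by
    rw [← sq_eq_sq₀ (norm_nonneg _) zero_le_one, Complex.sq_norm, Complex.normSq_apply]
    simp only [hz]; nlinarith
  have hpi := Real.pi_pos
  refine ⟨⟨Int.fract (z.arg / (2 * Real.pi)), Int.fract_nonneg _, (Int.fract_lt_one _).le⟩, ?_⟩
  have harg : 2 * Real.pi * Int.fract (z.arg / (2 * Real.pi))
      = z.arg - ⌊z.arg / (2 * Real.pi)⌋ * (2 * Real.pi) := by
    rw [Int.fract]; field_simp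
  have hz0 : z ≠ 0 := norm_ne_zero_iff.1 (by rw [hn]; exact one_ne_zero)
  apply Subtype.ext
  ext i
  fin_cases i
  · simp [circleLoop, harg, Real.cos_sub_int_mul_two_pi, Complex.cos_arg hz0, hn]
    rfl
  · simp [circleLoop, harg, Real.sin_sub_int_mul_two_pi, Complex.sin_arg, hn]
    rfl

lemma hasLogAt_range_of_simplyConnectedSpace {X : Type*} [TopologicalSpace X]
    [SimplyConnectedSpace X] {f : X → ℂ} (hf : Continuous f) {w : ℂ} (hw : ∀ x, f x ≠ w)
    {ψ : Metric.sphere (0 : EuclideanSpace ℝ (Fin 2)) 1 → X} (hψ : Continuous ψ)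
    (hinj : Function.Injective (f ∘ ψ)) : HasLogAt (range (f ∘ ψ)) w := by
  have hloop : circleLoop 0 = circleLoop 1 := by
    apply Subtype.ext; ext i; fin_cases i <;> simp [circleLoop]
  let F : C(X, {z : ℂ // z ≠ 0}) :=
    ⟨fun x => ⟨f x - w, sub_ne_zero.2 (hw x)⟩, by fun_prop⟩
  let p : Path (ψ (circleLoop 0)) (ψ (circleLoop 0)) :=
    { toFun := fun t => ψ (circleLoop t)
      continuous_toFun := hψ.comp continuous_circleLoop
      source' := rfl
      target' := by rw [hloop] }
  have hhom := SimplyConnectedSpace.paths_homotopic p (Path.refl _)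
  have hrel : (F.comp p.toContinuousMap).HomotopicRel
      (F.comp (Path.refl (ψ (circleLoop 0))).toContinuousMap) {0, 1} := ContinuousMap.HomotopicRel.comp_continuousMap hhom F
  set e : ℂ := Complex.log (f (ψ (circleLoop 0)) - w) with he
  have hexp : Complex.exp e = f (ψ (circleLoop 0)) - w := Complex.exp_log (sub_ne_zero.2 (hw _))
  have cov := Complex.isCoveringMap_exp
  have h0 : (F.comp p.toContinuousMap) 0 = ⟨Complex.exp e, e.exp_ne_zero⟩ :=
    Subtype.ext hexp.symm
  have h0' : (F.comp (Path.refl (ψ (circleLoop 0))).toContinuousMap) 0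
      = ⟨Complex.exp e, e.exp_ne_zero⟩ := Subtype.ext hexp.symm
  have hmon := cov.liftPath_apply_one_eq_of_homotopicRel hrel e h0 h0'
  set Γ := cov.liftPath (F.comp p.toContinuousMap) e h0 with hΓ
  have hconst : cov.liftPath (F.comp (Path.refl (ψ (circleLoop 0))).toContinuousMap) e h0' 1
      = e := by
    have := cov.liftPath_const (e := e) h0'
    exact congrArg (fun g : C(unitInterval, ℂ) => g 1) this
  have hΓ0 : Γ 0 = e := cov.liftPath_zero _ _ _
  have hΓ1 : Γ 1 = e := hmon.trans hconst
  have hΓe : ∀ t, Complex.exp (Γ t) = f (ψ (circleLoop t)) - w := fun t =>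
    congrArg Subtype.val (congrFun (cov.liftPath_lifts (F.comp p.toContinuousMap) e h0) t)
  have hq : Topology.IsQuotientMap circleLoop :=
    continuous_circleLoop.isClosedMap.isQuotientMap continuous_circleLoop surjective_circleLoop
  have hfac : Function.FactorsThrough Γ
      (⟨circleLoop, continuous_circleLoop⟩ : C(unitInterval, _)) := by
    intro s t hst
    rcases circleLoop_eq_iff hst with h | ⟨rfl, rfl⟩ | ⟨rfl, rfl⟩
    · rw [h]
    · rw [hΓ0, hΓ1]
    · rw [hΓ0, hΓ1]
  let L₀ := hq.lift (f := ⟨circleLoop, continuous_circleLoop⟩) Γ hfac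
  have hL₀ : ∀ t, L₀ (circleLoop t) = Γ t := fun t =>
    congrArg (fun g : C(unitInterval, ℂ) => g t)
      (hq.lift_comp (f := ⟨circleLoop, continuous_circleLoop⟩) Γ hfac)
  have hemb : Topology.IsEmbedding (f ∘ ψ) := ((hf.comp hψ).isClosedEmbedding hinj).isEmbedding
  have : Nonempty (Metric.sphere (0 : EuclideanSpace ℝ (Fin 2)) 1) := ⟨circleLoop 0⟩
  obtain ⟨g, hg, hgl⟩ := hemb.exists_continuousOn_leftInverse
  refine ⟨L₀ ∘ g, L₀.continuous.comp_continuousOn hg, ?_⟩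
  rintro _ ⟨x, rfl⟩
  obtain ⟨t, rfl⟩ := surjective_circleLoop x
  rw [Function.comp_apply, hgl, hL₀, hΓe, Function.comp_apply]

instance fact_finrank_euclideanSpace_two :
    Fact (Module.finrank ℝ (EuclideanSpace ℝ (Fin 2)) = 1 + 1) := ⟨by simp⟩

lemma isPreconnected_compl_singleton_circle
    (v : Metric.sphere (0 : EuclideanSpace ℝ (Fin 2)) 1) :
    IsPreconnected ({v}ᶜ : Set (Metric.sphere (0 : EuclideanSpace ℝ (Fin 2)) 1)) := by
  rw [← stereographic'_source (n := 1) v, ← (stereographic' 1 v).symm_image_target_eq_source,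
    stereographic'_target]
  refine isPreconnected_univ.image _ ?_
  have := (stereographic' 1 v).continuousOn_symm
  rwa [stereographic'_target] at this

lemma isPreconnected_simpleClosedCurve_diff_singleton {M : Type*} [TopologicalSpace M]
    {J : Set M} (hJ : IsSimpleClosedCurve J) {w : M} (hw : w ∈ J) :
    IsPreconnected (J \ {w}) := by
  obtain ⟨φ, hφ, hinj, rfl⟩ := hJ
  obtain ⟨v, rfl⟩ := hw
  have : range φ \ {φ v} = φ '' {v}ᶜ := by
    rw [image_compl_eq_range_sdiff_image hinj, image_singleton]
  rw [this]
  exact (isPreconnected_compl_singleton_circle v).image _ hφ.continuousOn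

/-- A continuous injective curve in a simple closed curve covers a neighbourhood of each of its
interior points. -/
lemma image_Ioo_mem_nhdsWithin {M : Type*} [TopologicalSpace M] [T2Space M] {J : Set M}
    (hJ : IsSimpleClosedCurve J) {γ : ℝ → M} {D : ℝ} (hγ : ContinuousOn γ (Icc 0 D))
    (hinj : InjOn γ (Icc 0 D)) (hmaps : MapsTo γ (Icc 0 D) J) {a b t : ℝ} (ha : 0 < a)
    (hb : b < D) (ht : t ∈ Ioo a b) : γ '' Ioo a b ∈ nhdsWithin (γ t) J := by
  obtain ⟨φ, hφ, hφi, rfl⟩ := hJ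
  have hab : a < b := ht.1.trans ht.2
  have h0 : (0 : ℝ) ∈ Icc 0 D := ⟨le_rfl, (ha.trans (hab.trans hb)).le⟩
  have hsub : Icc a b ⊆ Icc 0 D := Icc_subset_Icc ha.le hb.le
  obtain ⟨v, hv⟩ := hmaps h0
  have : Nonempty (Metric.sphere (0 : EuclideanSpace ℝ (Fin 2)) 1) := ⟨v⟩
  obtain ⟨g, hg, hgl⟩ := (hφ.isClosedEmbedding hφi).isEmbedding.exists_continuousOn_leftInverse
  have hgr : ∀ z ∈ range φ, φ (g z) = z := by rintro _ ⟨x, rfl⟩; rw [hgl]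
  have hgi : InjOn g (range φ) := fun x hx y hy h => by rw [← hgr x hx, ← hgr y hy, h]
  set ch : M → ℝ := fun z => stereographic' 1 v (g z) 0 with hch
  have hJ0 : MapsTo g (range φ \ {γ 0}) (stereographic' 1 v).source := fun z hz => by
    rw [stereographic'_source]
    intro h
    exact hz.2 (by rw [← hgr z hz.1, h, hv]; rfl)
  have hchc : ContinuousOn ch (range φ \ {γ 0}) :=
    (EuclideanSpace.proj (𝕜 := ℝ) (0 : Fin 1)).continuous.comp_continuousOn
      ((stereographic' 1 v).continuousOn.comp (hg.mono sdiff_subset) hJ0)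
  have hchi : InjOn ch (range φ \ {γ 0}) := by
    intro x hx y hy h
    refine hgi hx.1 hy.1 ((stereographic' 1 v).injOn (hJ0 hx) (hJ0 hy) ?_)
    ext i
    fin_cases i
    exact h
  have hm : MapsTo γ (Icc a b) (range φ \ {γ 0}) := fun s hs =>
    ⟨hmaps (hsub hs), fun h => (ha.trans_le hs.1).ne' (hinj (hsub hs) h0 h)⟩
  have hc : ContinuousOn (ch ∘ γ) (Icc a b) := hchc.comp (hγ.mono hsub) hm
  have hi : InjOn (ch ∘ γ) (Icc a b) := hchi.comp (hinj.mono hsub) hm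
  have hnhds : (ch ∘ γ) '' Ioo a b ∈ nhds (ch (γ t)) := by
    rcases hc.strictMonoOn_of_injOn_Icc' hab.le hi with h | h
    · have h1 := h ⟨le_rfl, hab.le⟩ (Ioo_subset_Icc_self ht) ht.1
      have h2 := h (Ioo_subset_Icc_self ht) ⟨hab.le, le_rfl⟩ ht.2
      exact Filter.mem_of_superset (Ioo_mem_nhds h1 h2) (intermediate_value_Ioo hab.le hc)
    · have h1 := h ⟨le_rfl, hab.le⟩ (Ioo_subset_Icc_self ht) ht.1
      have h2 := h (Ioo_subset_Icc_self ht) ⟨hab.le, le_rfl⟩ ht.2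
      exact Filter.mem_of_superset (Ioo_mem_nhds h2 h1) (intermediate_value_Ioo' hab.le hc)
  have htm := hm (Ioo_subset_Icc_self ht)
  have h1 := (hchc (γ t) htm).preimage_mem_nhdsWithin hnhds
  have h2 : nhdsWithin (γ t) (range φ \ {γ 0}) = nhdsWithin (γ t) (range φ) := by
    rw [sdiff_eq]
    exact nhdsWithin_inter_of_mem' (mem_nhdsWithin_of_mem_nhds
      (isOpen_compl_singleton.mem_nhds htm.2))
  rw [← h2]
  filter_upwards [h1, self_mem_nhdsWithin] with z hz hz'
  obtain ⟨s, hs, hsz⟩ := hz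
  exact ⟨s, hs, hchi (hm (Ioo_subset_Icc_self hs)) hz' hsz⟩

lemma exists_hasDerivAt_ne_zero {γ : ℝ → ℂ} {D : ℝ} (hγ : LipschitzOnWith 1 γ (Icc 0 D))
    (hinj : InjOn γ (Icc 0 D)) {a b : ℝ} (ha : 0 < a) (hab : a < b) (hb : b < D) :
    ∃ t ∈ Icc a b, ∃ v, v ≠ 0 ∧ HasDerivAt γ v t := by
  by_contra! hcon
  have hsub : Icc a b ⊆ Icc 0 D := Icc_subset_Icc ha.le hb.le
  have hac : AbsolutelyContinuousOnInterval γ a b :=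
    LipschitzOnWith.absolutelyContinuousOnInterval (K := 1)
      ((uIcc_of_le hab.le).symm ▸ hγ.mono hsub)
  obtain ⟨C, hC⟩ := hac.const_of_ae_hasDerivAt_zero (by
    rw [uIcc_of_le hab.le]
    filter_upwards [hγ.ae_differentiableWithinAt_of_mem_real] with x hx hxab
    have hd := ((hx (hsub hxab)).differentiableAt
      (Icc_mem_nhds (ha.trans_le hxab.1) (hxab.2.trans_lt hb))).hasDerivAt
    by_cases h0 : deriv γ x = 0
    · rwa [h0] at hd
    · exact absurd hd (hcon x hxab _ h0))
  rw [uIcc_of_le hab.le] at hC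
  have h1 : a ∈ Icc a b := ⟨le_rfl, hab.le⟩
  have h2 : b ∈ Icc a b := ⟨hab.le, le_rfl⟩
  exact hab.ne (hinj (hsub h1) (hsub h2) ((hC a h1).trans (hC b h2).symm))

/-- If a curve in `J` passes through `γ t₀` with nonzero velocity, covers `J` near `γ t₀`, and
`J \ {γ t₀}` is connected, then the logarithm obstruction changes across the curve, so some point
arbitrarily close to `γ t₀` has no logarithm on `J`. -/
lemma exists_not_hasLogAt_of_hasDerivAt {J : Set ℂ} {γ : ℝ → ℂ} {t₀ : ℝ} {v : ℂ}
    (hconn : IsPreconnected (J \ {γ t₀})) (hv : v ≠ 0) (hder : HasDerivAt γ v t₀)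
    (hJ : ∀ᶠ t in nhds t₀, γ t ∈ J)
    (hnear : ∀ U ∈ nhds t₀, γ '' U ∈ nhdsWithin (γ t₀) J) {V : Set ℂ} (hV : V ∈ nhds (γ t₀)) :
    ∃ w ∈ V, w ∉ J ∧ ¬ HasLogAt J w := by
  set w₀ := γ t₀ with hw₀
  set ζ : ℂ → ℂ := fun z => (z - w₀) / v with hζ
  have hζv : ∀ z, z = w₀ + ζ z * v := fun z => by simp only [hζ]; field_simp; ring
  have hU : ∀ᶠ t in nhds t₀, ‖ζ (γ t) - ((t - t₀ : ℝ) : ℂ)‖ ≤ 1 / 2 * |t - t₀| := by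
    have h1 := (hasDerivAt_iff_isLittleO.1 hder).def
      (show 0 < 1 / 2 * ‖v‖ by have := norm_pos_iff.2 hv; positivity)
    filter_upwards [h1] with t ht
    have h2 : ζ (γ t) - ((t - t₀ : ℝ) : ℂ) = (γ t - γ t₀ - (t - t₀) • v) / v := by
      simp only [hζ, Complex.real_smul]
      field_simp
      rfl
    rw [h2, norm_div, div_le_iff₀ (norm_pos_iff.2 hv)]
    rw [Real.norm_eq_abs] at ht
    linarith
  have hre : ∀ t, ‖ζ (γ t) - ((t - t₀ : ℝ) : ℂ)‖ ≤ 1 / 2 * |t - t₀| →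
      |(ζ (γ t)).re - (t - t₀)| ≤ 1 / 2 * |t - t₀| := fun t ht => by
    refine le_trans ?_ ht
    simpa using Complex.abs_re_le_norm (ζ (γ t) - ((t - t₀ : ℝ) : ℂ))
  obtain ⟨r, hr, hrsub⟩ := Metric.mem_nhdsWithin_iff.1 (hnear _ hU)
  obtain ⟨r', hr', hrV⟩ := Metric.mem_nhds_iff.1 hV
  have hvp := norm_pos_iff.2 hv
  set η : ℝ := min r r' / (2 * ‖v‖) with hη
  have hηp : 0 < η := by have := lt_min hr hr'; positivity
  have hηv : η * ‖v‖ < min r r' := by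
    have := lt_min hr hr'
    rw [hη]; field_simp; linarith
  set wm : ℂ := w₀ - Complex.I * η * v with hwm
  set wp : ℂ := w₀ + Complex.I * η * v with hwp
  have hdist : ∀ z ∈ segment ℝ wm wp, dist z w₀ < min r r' := by
    have hb : ∀ z ∈ ({wm, wp} : Set ℂ), z ∈ Metric.ball w₀ (min r r') := by
      rintro z (rfl | rfl) <;>
      simp [hwm, hwp, dist_eq_norm, abs_of_pos hηp] <;> exact lt_min_iff.1 hηv
    exact fun z hz => (convex_ball w₀ (min r r')).segment_subset
      (hb wm (by simp)) (hb wp (by simp)) hz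
  have hseg0 : ∀ z ∈ segment ℝ wm wp, (ζ z).re = 0 := by
    rintro z ⟨a, b, -, -, hab, rfl⟩
    have : ζ (a • wm + b • wp) = Complex.I * (((b - a) * η : ℝ) : ℂ) := by
      have hab' : (a : ℂ) + b = 1 := by exact_mod_cast hab
      simp only [hζ, hwm, hwp, Complex.real_smul]
      push_cast
      rw [div_eq_iff hv]
      linear_combination w₀ * hab'
    rw [this]; simp
  have hsegJ : ∀ z ∈ segment ℝ wm wp, z ∈ J → z = w₀ := by
    intro z hz hzJ
    obtain ⟨t, ht, rfl⟩ := hrsub ⟨(hdist z hz).trans_le (min_le_left _ _), hzJ⟩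
    have h1 := hre t ht
    rw [hseg0 _ hz, zero_sub, abs_neg] at h1
    have h2 : |t - t₀| = 0 := by linarith [abs_nonneg (t - t₀)]
    rw [sub_eq_zero.1 (abs_eq_zero.1 h2)]
  have hne : Complex.I * η * v ≠ 0 :=
    mul_ne_zero (mul_ne_zero Complex.I_ne_zero (by exact_mod_cast hηp.ne')) hv
  have hwmJ : wm ∉ J := fun h => hne (by
    have := hsegJ _ (left_mem_segment ℝ wm wp) h
    rw [hwm] at this; linear_combination -this)
  have hwpJ : wp ∉ J := fun h => hne (by
    have := hsegJ _ (right_mem_segment ℝ wm wp) h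
    rw [hwp] at this; linear_combination this)
  by_contra! hcon
  obtain ⟨L₁, hL₁, hL₁e⟩ := hcon wm (hrV ((hdist _ (left_mem_segment ℝ wm wp)).trans_le
    (min_le_right _ _))) hwmJ
  obtain ⟨L₂, hL₂, hL₂e⟩ := hcon wp (hrV ((hdist _ (right_mem_segment ℝ wm wp)).trans_le
    (min_le_right _ _))) hwpJ
  set F : ℂ → ℂ := fun z => (z - wm) / (z - wp) with hF
  have hslit : ∀ z ∈ J \ {w₀}, F z ∈ Complex.slitPlane := fun z hz =>
    div_mem_slitPlane_of_notMem_segment fun h => hz.2 (hsegJ z h hz.1)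
  have hpne : ∀ z ∈ J, z - wp ≠ 0 := fun z hz h => hwpJ (sub_eq_zero.1 h ▸ hz)
  have hw₀J : w₀ ∈ J := hJ.self_of_nhds
  have hFc : ContinuousOn F J :=
    (by fun_prop : ContinuousOn (fun z : ℂ => z - wm) J).div (by fun_prop) hpne
  set G : ℂ → ℂ := fun z => L₁ z - L₂ z - Complex.log (F z) with hG
  have hGc : ContinuousOn G (J \ {w₀}) :=
    ((hL₁.sub hL₂).mono sdiff_subset).sub ((hFc.mono sdiff_subset).clog hslit)
  have hGe : ∀ z ∈ J \ {w₀}, ∃ n : ℤ, G z = n * (2 * Real.pi * Complex.I) := fun z hz => by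
    rw [← Complex.exp_eq_one_iff, hG, Complex.exp_sub, Complex.exp_sub,
      Complex.exp_log (Complex.slitPlane_ne_zero (hslit z hz)), hL₁e z hz.1, hL₂e z hz.1]
    exact div_self (Complex.slitPlane_ne_zero (hslit z hz))
  have hGconst : ∀ z ∈ J \ {w₀}, ∀ z' ∈ J \ {w₀}, G z = G z' := by
    have hpi : (2 * Real.pi : ℝ) ≠ 0 := by positivity
    intro z hz z' hz'
    have hd : IsDiscrete (range ((↑) : ℤ → ℝ)) :=
      Int.isClosedEmbedding_coe_real.isInducing.isDiscrete_range
    have h := hconn.constant_of_mapsTo hd (f := fun z => (G z).im / (2 * Real.pi))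
      ((Complex.continuous_im.comp_continuousOn hGc).div_const _) (fun x hx => by
        obtain ⟨n, hn⟩ := hGe x hx
        refine ⟨n, ?_⟩
        simp [hn]) hz hz'
    obtain ⟨n, hn⟩ := hGe z hz
    obtain ⟨n', hn'⟩ := hGe z' hz'
    simp [hn, hn'] at h
    rw [hn, hn', h]
  have hFw : F w₀ = -1 := by
    simp only [hF, hwm, hwp]
    rw [div_eq_iff (by simpa using hne)]
    ring
  have hFim : ∀ z ∈ J, 0 < (F z).im * (ζ z).re ∨ (ζ z).re = 0 := by
    intro z hz
    by_cases h0 : (ζ z).re = 0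
    · exact Or.inr h0
    left
    have h1 : F z = (ζ z + Complex.I * η) / (ζ z - Complex.I * η) := by
      have h2 : z - wm = (ζ z + Complex.I * η) * v := by
        rw [hwm]; linear_combination hζv z
      have h3 : z - wp = (ζ z - Complex.I * η) * v := by
        rw [hwp]; linear_combination hζv z
      simp only [hF]
      rw [h2, h3, mul_div_mul_right _ _ hv]
    have hnn : 0 < Complex.normSq (ζ z - Complex.I * η) := by
      rw [Complex.normSq_pos]
      intro h
      apply h0
      simpa using congrArg Complex.re h
    have h4 : (F z).im * (ζ z).re
        = 2 * η * (ζ z).re ^ 2 / Complex.normSq (ζ z - Complex.I * η) := by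
      rw [h1, Complex.div_im]
      simp
      field_simp
      ring
    rw [h4]
    have : 0 < (ζ z).re ^ 2 := by positivity
    positivity
  have hγJ : Filter.Tendsto γ (nhds t₀) (nhdsWithin w₀ J) :=
    tendsto_nhdsWithin_iff.2 ⟨hder.continuousAt, hJ⟩
  have hFγ : Filter.Tendsto (fun t => F (γ t)) (nhds t₀) (nhds (-1)) := by
    have := (hFc w₀ hw₀J).tendsto.comp hγJ
    rwa [hFw] at this
  have hMγ : Filter.Tendsto (fun t => L₁ (γ t) - L₂ (γ t)) (nhds t₀) (nhds (L₁ w₀ - L₂ w₀)) :=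
    ((hL₁.sub hL₂) w₀ hw₀J).tendsto.comp hγJ
  have hpos : ∀ᶠ t in nhdsWithin t₀ (Ioi t₀), 0 < (F (γ t)).im ∧ γ t ∈ J \ {w₀} := by
    filter_upwards [nhdsWithin_le_nhds hU, nhdsWithin_le_nhds hJ, self_mem_nhdsWithin]
      with t ht htJ hlt
    have hlt' : 0 < t - t₀ := sub_pos.2 hlt
    have h1 := abs_le.1 (hre t ht)
    rw [abs_of_pos hlt'] at h1
    have h2 : 0 < (ζ (γ t)).re := by linarith [h1.1]
    refine ⟨?_, htJ, fun h => ?_⟩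
    · rcases hFim _ htJ with h | h
      · exact (pos_iff_pos_of_mul_pos h).2 h2
      · exact absurd h h2.ne'
    · rw [mem_singleton_iff] at h
      rw [h] at h2
      simp [hζ] at h2
  have hneg : ∀ᶠ t in nhdsWithin t₀ (Iio t₀), (F (γ t)).im < 0 ∧ γ t ∈ J \ {w₀} := by
    filter_upwards [nhdsWithin_le_nhds hU, nhdsWithin_le_nhds hJ, self_mem_nhdsWithin]
      with t ht htJ hlt
    have hlt' : t - t₀ < 0 := sub_neg.2 hlt
    have h1 := abs_le.1 (hre t ht)
    rw [abs_of_neg hlt'] at h1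
    have h2 : (ζ (γ t)).re < 0 := by linarith [h1.2]
    refine ⟨?_, htJ, fun h => ?_⟩
    · rcases hFim _ htJ with h | h
      · exact (neg_iff_neg_of_mul_pos h).2 h2
      · exact absurd h h2.ne
    · rw [mem_singleton_iff] at h
      rw [h] at h2
      simp [hζ] at h2
  have hlogp : Filter.Tendsto (fun t => Complex.log (F (γ t))) (nhdsWithin t₀ (Ioi t₀))
      (nhds (Real.pi * Complex.I)) := by
    have h := Complex.tendsto_log_nhdsWithin_im_nonneg_of_re_neg_of_im_zero
      (z := -1) (by simp) (by simp)
    have h' := h.comp (tendsto_nhdsWithin_iff.2 ⟨hFγ.mono_left nhdsWithin_le_nhds,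
      hpos.mono fun t ht => ht.1.le⟩)
    simpa [Function.comp_def] using h'
  have hlogn : Filter.Tendsto (fun t => Complex.log (F (γ t))) (nhdsWithin t₀ (Iio t₀))
      (nhds (-(Real.pi * Complex.I))) := by
    have h := Complex.tendsto_log_nhdsWithin_im_neg_of_re_neg_of_im_zero
      (z := -1) (by simp) (by simp)
    have h' := h.comp (tendsto_nhdsWithin_iff.2 ⟨hFγ.mono_left nhdsWithin_le_nhds,
      hneg.mono fun t ht => ht.1⟩)
    simpa [Function.comp_def] using h'
  obtain ⟨t₁, ht₁⟩ := hpos.exists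
  have hp := tendsto_nhds_unique ((hMγ.mono_left nhdsWithin_le_nhds).sub hlogp)
    (tendsto_const_nhds.congr' (hpos.mono fun t ht => hGconst _ ht₁.2 _ ht.2))
  have hn := tendsto_nhds_unique ((hMγ.mono_left nhdsWithin_le_nhds).sub hlogn)
    (tendsto_const_nhds.congr' (hneg.mono fun t ht => hGconst _ ht₁.2 _ ht.2))
  have : (Real.pi : ℂ) * Complex.I = 0 := by linear_combination (hn - hp) / 2
  exact mul_ne_zero (by exact_mod_cast Real.pi_ne_zero) Complex.I_ne_zero this

lemma exists_forall_not_hasLogAt_ray {J : Set ℂ} (hJ : IsCompact J) {u d : ℂ} (hd : d ≠ 0)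
    (huJ : u ∉ J) (hu : ¬ HasLogAt J u) :
    ∃ l : ℝ, 0 < l ∧ u + l * d ∈ J ∧
      ∀ m : ℝ, 0 ≤ m → m < l → u + m * d ∉ J ∧ ¬ HasLogAt J (u + m * d) := by
  have key : ∀ m : ℝ, 0 ≤ m → (∀ k : ℝ, 0 ≤ k → k ≤ m → u + k * d ∉ J) →
      ¬ HasLogAt J (u + m * d) := by
    intro m hm hk hlog
    refine hu (hlog.of_segment_disjoint (Set.disjoint_left.2 ?_))
    rintro _ ⟨a, b, ha, hb, hab, rfl⟩
    have : a • u + b • (u + m * d) = u + ((b * m : ℝ) : ℂ) * d := by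
      have hab' : (a : ℂ) + b = 1 := by exact_mod_cast hab
      simp only [Complex.real_smul]
      push_cast
      linear_combination u * hab'
    rw [this]
    exact hk _ (by positivity) (by nlinarith)
  set S : Set ℝ := {l | 0 ≤ l ∧ u + l * d ∈ J} with hS
  have hSc : IsClosed S := by
    refine isClosed_Ici.inter (hJ.isClosed.preimage ?_)
    fun_prop
  have hSb : BddBelow S := ⟨0, fun x hx => hx.1⟩
  have hSn : S.Nonempty := by
    by_contra hempty
    obtain ⟨R, hR⟩ := hJ.isBounded.exists_norm_le
    have hdp := norm_pos_iff.2 hd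
    set m : ℝ := (‖u‖ + |R| + 1) / ‖d‖ with hm
    have hm0 : 0 ≤ m := by positivity
    refine key m hm0 (fun k hk _ h => hempty ⟨k, hk, h⟩) (hasLogAt_of_forall_norm_lt fun z hz => ?_)
    have h1 : ‖(m : ℂ) * d‖ = ‖u‖ + |R| + 1 := by
      rw [norm_mul, Complex.norm_real, Real.norm_of_nonneg hm0, hm]
      field_simp
    have h2 : ‖(m : ℂ) * d‖ ≤ ‖u + m * d‖ + ‖u‖ := by
      have := norm_sub_le (u + m * d) u
      simpa using this
    linarith [hR z hz, le_abs_self R]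
  have hmem : sInf S ∈ S := hSc.csInf_mem hSn hSb
  have hnot : ∀ k : ℝ, 0 ≤ k → k < sInf S → u + k * d ∉ J := fun k hk hlt h =>
    notMem_of_lt_csInf hlt hSb ⟨hk, h⟩
  refine ⟨sInf S, lt_of_le_of_ne hmem.1 fun h => huJ ?_, hmem.2, fun m hm hlt =>
    ⟨hnot m hm hlt, key m hm fun k hk hkm => hnot k hk (hkm.trans_lt hlt)⟩⟩
  have := hmem.2
  rw [← h] at this
  simpa using this

/-- A curve in a simple closed curve `J` which is distance-minimizing in `E ⊇ J`, where `E` contains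
every point that `J` winds around, has no interior point farthest from some `o` among the points
of `J`. -/
lemma exists_dist_lt_dist_of_geodesic {J E : Set ℂ} (hJ : IsSimpleClosedCurve J) (hJE : J ⊆ E)
    (hE : ∀ w, w ∉ E → HasLogAt J w) {γ : ℝ → ℂ} {D : ℝ}
    (hγ : LipschitzOnWith 1 γ (Icc 0 D)) (hinj : InjOn γ (Icc 0 D))
    (hmaps : MapsTo γ (Icc 0 D) J)
    (hgeo : ∀ s ∈ Icc 0 D, ∀ t ∈ Icc 0 D, segment ℝ (γ s) (γ t) ⊆ E →
      |s - t| ≤ dist (γ s) (γ t))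
    {t₀ : ℝ} (ht₀ : t₀ ∈ Ioo 0 D) (o : ℂ) : ∃ z ∈ J, dist (γ t₀) o < dist z o := by
  by_contra! hfar
  have hJc : IsCompact J := by
    obtain ⟨φ, hφ, -, rfl⟩ := hJ
    exact isCompact_range hφ
  have h0 : (0 : ℝ) ∈ Icc 0 D := ⟨le_rfl, (ht₀.1.trans ht₀.2).le⟩
  have ht₀' := Ioo_subset_Icc_self ht₀
  set n : ℂ := γ t₀ - o with hn
  have hn0 : n ≠ 0 := by
    intro h
    have h1 := hfar _ (hmaps h0)
    rw [dist_eq_norm (γ t₀), ← hn, h, norm_zero] at h1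
    have h2 := dist_le_zero.1 h1
    rw [← sub_eq_zero.1 h] at h2
    exact ht₀.1.ne (hinj h0 ht₀' h2)
  have hcap : ∀ z ∈ J, ‖z - γ t₀‖ ^ 2 ≤ 2 * inner ℝ (γ t₀ - z) n := by
    intro z hz
    have h1 := hfar z hz
    rw [dist_eq_norm, dist_eq_norm, ← hn] at h1
    have h2 : z - o = n - (γ t₀ - z) := by rw [hn]; ring
    have h3 : ‖z - o‖ ^ 2 ≤ ‖n‖ ^ 2 := by gcongr
    rw [h2, norm_sub_sq_real, real_inner_comm] at h3
    rw [norm_sub_rev]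
    linarith
  have hN := image_Ioo_mem_nhdsWithin hJ hγ.continuousOn hinj hmaps (a := t₀ / 2)
    (b := (t₀ + D) / 2) (t := t₀) (by linarith [ht₀.1]) (by linarith [ht₀.2])
    ⟨by linarith [ht₀.1], by linarith [ht₀.2]⟩
  obtain ⟨ε, hε, hεsub⟩ := Metric.mem_nhdsWithin_iff.1 hN
  set V : Set ℂ := {w | 2 * inner ℝ (γ t₀ - w) n < ε ^ 2} with hV
  have hVo : IsOpen V := isOpen_lt (by fun_prop) continuous_const
  have hVt : V ∈ nhds (γ t₀) := hVo.mem_nhds (by simp [hV]; positivity)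
  have hIcc : Icc 0 D ∈ nhds t₀ := Icc_mem_nhds ht₀.1 ht₀.2
  have hcont : ContinuousAt γ t₀ := hγ.continuousOn.continuousAt hIcc
  obtain ⟨a, b, ht₀ab, hab⟩ := mem_nhds_iff_exists_Ioo_subset.1
    (Filter.inter_mem (hcont hVt) (Ioo_mem_nhds ht₀.1 ht₀.2))
  have hlt : (a + t₀) / 2 < (t₀ + b) / 2 := by linarith [ht₀ab.1, ht₀ab.2]
  have hsub : Icc ((a + t₀) / 2) ((t₀ + b) / 2) ⊆ Ioo a b := fun x hx =>
    ⟨by linarith [hx.1, ht₀ab.1], by linarith [hx.2, ht₀ab.2]⟩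
  obtain ⟨t₁, ht₁, v, hv, hder⟩ := exists_hasDerivAt_ne_zero hγ hinj
    (hab (hsub ⟨le_rfl, hlt.le⟩)).2.1 hlt (hab (hsub ⟨hlt.le, le_rfl⟩)).2.2
  obtain ⟨ht₁V, ht₁D⟩ := hab (hsub ht₁)
  obtain ⟨u, huV, huJ, hu⟩ := exists_not_hasLogAt_of_hasDerivAt
    (isPreconnected_simpleClosedCurve_diff_singleton hJ (hmaps (Ioo_subset_Icc_self ht₁D)))
    hv hder (Filter.mem_of_superset (Icc_mem_nhds ht₁D.1 ht₁D.2) hmaps)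
    (fun U hU => by
      obtain ⟨c, d, ht₁cd, hcd⟩ := mem_nhds_iff_exists_Ioo_subset.1 hU
      refine Filter.mem_of_superset (image_Ioo_mem_nhdsWithin hJ hγ.continuousOn hinj hmaps
        (a := max c (t₁ / 2)) (b := min d ((t₁ + D) / 2)) ?_ ?_ ?_) (image_mono ?_)
      · exact lt_max_of_lt_right (by linarith [ht₁D.1])
      · exact min_lt_of_right_lt (by linarith [ht₁D.2])
      · exact ⟨max_lt ht₁cd.1 (by linarith [ht₁D.1]), lt_min ht₁cd.2 (by linarith [ht₁D.2])⟩
      · exact (Ioo_subset_Ioo (le_max_left _ _) (min_le_left _ _)).trans hcd)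
    (hVo.mem_nhds ht₁V)
  set d : ℂ := Complex.I * n with hd
  have hd0 : d ≠ 0 := mul_ne_zero Complex.I_ne_zero hn0
  have hdn : inner ℝ d n = 0 := by
    simp [hd, Complex.inner]; ring
  obtain ⟨l, hl, hlJ, hlr⟩ := exists_forall_not_hasLogAt_ray hJc hd0 huJ hu
  obtain ⟨l', hl', hlJ', hlr'⟩ := exists_forall_not_hasLogAt_ray hJc (neg_ne_zero.2 hd0) huJ hu
  have hline : ∀ k : ℝ, -l' < k → k < l → u + k * d ∉ J ∧ ¬ HasLogAt J (u + k * d) := by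
    intro k hk hk'
    rcases le_total 0 k with h | h
    · exact hlr k h hk'
    · have := hlr' (-k) (by linarith) (by linarith)
      simpa using this
  have hcover : ∀ k : ℝ, u + k * d ∈ J → ∃ s ∈ Icc 0 D, γ s = u + k * d := by
    intro k hk
    have h1 := hcap _ hk
    have h2 : γ t₀ - (u + k * d) = (γ t₀ - u) - k • d := by
      rw [Complex.real_smul]; ring
    rw [h2, inner_sub_left, real_inner_smul_left, hdn] at h1
    have h3 : ‖u + k * d - γ t₀‖ < ε := by
      refine lt_of_pow_lt_pow_left₀ 2 hε.le (lt_of_le_of_lt h1 ?_)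
      have : 2 * inner ℝ (γ t₀ - u) n < ε ^ 2 := huV
      linarith
    obtain ⟨s, hs, hse⟩ := hεsub ⟨mem_ball_iff_norm.2 h3, hk⟩
    exact ⟨s, ⟨by linarith [hs.1, ht₀.1], by linarith [hs.2, ht₀.2]⟩, hse⟩
  obtain ⟨s, hs, hsA⟩ := hcover l hlJ
  have hlJ'' : u + ((-l' : ℝ) : ℂ) * d ∈ J := by simpa using hlJ'
  obtain ⟨t, ht, htB⟩ := hcover (-l') hlJ''
  have hseg : segment ℝ (γ s) (γ t) ⊆ E := by
    rintro _ ⟨x, y, hx, hy, hxy, rfl⟩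
    have hxy' : (x : ℂ) + y = 1 := by exact_mod_cast hxy
    have h1 : x • γ s + y • γ t = u + ((x * l - y * l' : ℝ) : ℂ) * d := by
      rw [hsA, htB]
      simp only [Complex.real_smul]
      push_cast
      linear_combination u * hxy'
    rw [h1]
    rcases hx.eq_or_lt with rfl | hx'
    · rw [zero_add] at hxy
      subst hxy
      simpa using hJE hlJ'
    rcases hy.eq_or_lt with rfl | hy'
    · rw [add_zero] at hxy
      subst hxy
      simpa using hJE hlJ
    by_contra hnE
    exact (hline (x * l - y * l') (by nlinarith) (by nlinarith)).2 (hE _ hnE)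
  have hlen := hgeo s hs t ht hseg
  have hmid : (s + t) / 2 ∈ Icc 0 D :=
    ⟨by linarith [hs.1, ht.1], by linarith [hs.2, ht.2]⟩
  have h1 : dist (γ s) (γ ((s + t) / 2)) ≤ |s - t| / 2 := by
    have := hγ.dist_le_mul s hs _ hmid
    rw [NNReal.coe_one, one_mul, Real.dist_eq, show s - (s + t) / 2 = (s - t) / 2 by ring,
      abs_div, abs_two] at this
    exact this
  have h2 : dist (γ ((s + t) / 2)) (γ t) ≤ |s - t| / 2 := by
    have := hγ.dist_le_mul _ hmid t ht
    rw [NNReal.coe_one, one_mul, Real.dist_eq, show (s + t) / 2 - t = (s - t) / 2 by ring,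
      abs_div, abs_two] at this
    exact this
  have h3 := dist_triangle (γ s) (γ ((s + t) / 2)) (γ t)
  have h4 : γ ((s + t) / 2) = midpoint ℝ (γ s) (γ t) :=
    eq_midpoint_of_dist_eq_half (by linarith) (by linarith)
  have h5 : midpoint ℝ (γ s) (γ t) = u + (((l - l') / 2 : ℝ) : ℂ) * d := by
    rw [midpoint_eq_smul_add, hsA, htB, Complex.real_smul]
    push_cast
    norm_num
    ring
  refine (hline ((l - l') / 2) (by linarith) (by linarith)).1 ?_
  rw [← h5, ← h4]
  exact hmaps hmid

lemma edist_le_pathEDist {X : Type*} [PseudoEMetricSpace X] (x y : X) :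
    edist x y ≤ pathEDist x y := by
  refine le_iInf fun c => ?_
  have := eVariationOn.edist_le (fun t : unitInterval => c t) (mem_univ 0) (mem_univ 1)
  simpa [pathLength] using this

lemma pathEDist_le_of_segment_subset {V : Type*} [NormedAddCommGroup V] [NormedSpace ℝ V]
    {E : Set V} {x y : E} (h : segment ℝ (x : V) y ⊆ E) :
    pathEDist x y ≤ edist x y := by
  have hmem : ∀ t : unitInterval, AffineMap.lineMap (x : V) (y : V) (t : ℝ) ∈ E := fun t =>
    h (by rw [segment_eq_image_lineMap]; exact ⟨t, t.2, rfl⟩)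
  let c : Path x y :=
    { toFun := fun t => ⟨AffineMap.lineMap (x : V) (y : V) (t : ℝ), hmem t⟩
      continuous_toFun := by
        refine Continuous.subtype_mk ?_ _
        exact AffineMap.lineMap_continuous.comp continuous_subtype_val
      source' := by ext; simp
      target' := by ext; simp }
  refine (iInf_le _ c).trans ?_
  have hlip : LipschitzOnWith (nndist x y) (fun t : ℝ => (AffineMap.lineMap (x : V) (y : V) t : V))
      univ := by
    refine (LipschitzWith.of_dist_le_mul fun s t => ?_).lipschitzOnWith
    rw [dist_lineMap_lineMap, mul_comm]
    rfl
  have h1 := hlip.comp_eVariationOn_le (g := fun t : unitInterval => (t : ℝ)) (s := univ)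
    (mapsTo_univ _ _)
  have h2 : eVariationOn (fun t : unitInterval => (t : ℝ)) univ ≤ ENNReal.ofReal (1 - 0) := by
    have hm : MonotoneOn (fun t : unitInterval => (t : ℝ)) univ := fun a _ b _ hab => hab
    have := (hm.eVariationOn_eq (mem_univ 0) (mem_univ 1)).le
    refine le_trans (eVariationOn.mono _ fun t _ => ?_) this
    exact ⟨mem_univ _, t.2.1, t.2.2⟩
  calc pathLength c ≤ (nndist x y : ENNReal) *
        eVariationOn (fun t : unitInterval => (t : ℝ)) univ := h1
    _ ≤ (nndist x y : ENNReal) * ENNReal.ofReal (1 - 0) := by gcongr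
    _ = edist x y := by rw [sub_zero, ENNReal.ofReal_one, mul_one, edist_nndist]

namespace IsGeodesicSegment

variable {X : Type*} [MetricSpace X] {γ : ℝ → X} {D : ℝ} {x y : X}

lemma lipschitzOnWith (h : IsGeodesicSegment γ D x y) : LipschitzOnWith 1 γ (Icc 0 D) := by
  intro s hs t ht
  refine (edist_le_pathEDist _ _).trans ?_
  rw [h.2.2 s hs t ht, edist_dist, Real.dist_eq, ENNReal.coe_one, one_mul]

lemma injOn (h : IsGeodesicSegment γ D x y) : InjOn γ (Icc 0 D) := by
  intro s hs t ht hst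
  have h1 := h.2.2 s hs t ht
  have h2 : pathEDist (γ s) (γ t) = 0 := by
    rw [← hst, h.2.2 s hs s hs]; simp
  rw [h2, eq_comm, ENNReal.ofReal_eq_zero] at h1
  exact sub_eq_zero.1 (abs_nonpos_iff.1 h1)

end IsGeodesicSegment

/-- A point outside the convex hull of a finite set is strictly farther than all of its points from
some centre. -/
lemma exists_forall_dist_lt_of_notMem_convexHull {V : Type*} [NormedAddCommGroup V]
    [InnerProductSpace ℝ V] [CompleteSpace V] {S : Set V} (hS : S.Finite) {z : V}
    (hz : z ∉ convexHull ℝ S) : ∃ o : V, ∀ v ∈ S, dist v o < dist z o := by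
  obtain ⟨f, c, hfc, hcz⟩ := geometric_hahn_banach_closed_point (convex_convexHull ℝ S)
    (hS.isClosed_convexHull ℝ) hz
  set n : V := (InnerProductSpace.toDual ℝ V).symm f with hn
  have hnf : ∀ v, inner ℝ n v = f v := fun v => InnerProductSpace.toDual_symm_apply
  have hR : ∀ v ∈ S, ∃ R₀ : ℝ, ∀ R ≥ R₀, dist v (z - R • n) < dist z (z - R • n) := by
    intro v hv
    have hneg : 0 < f z - f v := by linarith [hfc v (subset_convexHull ℝ S hv)]
    refine ⟨(‖v - z‖ ^ 2 + 1) / (2 * (f z - f v)), fun R hR => ?_⟩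
    have h1 : ‖v - z‖ ^ 2 + 1 ≤ R * (2 * (f z - f v)) := (div_le_iff₀ (by positivity)).1 hR
    rw [dist_eq_norm, dist_eq_norm]
    refine lt_of_pow_lt_pow_left₀ 2 (norm_nonneg _) ?_
    rw [show v - (z - R • n) = (v - z) + R • n by abel, norm_add_sq_real,
      real_inner_smul_right, real_inner_comm, hnf, map_sub, show z - (z - R • n) = R • n by abel]
    nlinarith
  choose! R hR using hR
  obtain ⟨R₁, hR₁⟩ := (hS.image R).bddAbove
  exact ⟨z - R₁ • n, fun v hv => hR v hv R₁ (hR₁ (mem_image_of_mem R hv))⟩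

/-- The endpoints of a geodesic segment contained in a simple closed curve in a simply connected
planar set are the only points of the segment that can be farthest from `o` on the curve. -/
lemma IsGeodesicSegment.exists_dist_lt_dist {E : Set (EuclideanSpace ℝ (Fin 2))}
    [SimplyConnectedSpace E] {J : Set (EuclideanSpace ℝ (Fin 2))} (hJ : IsSimpleClosedCurve J)
    (hJE : J ⊆ E) {γ : ℝ → E} {D : ℝ} {x y : E} (hγ : IsGeodesicSegment γ D x y)
    (hmaps : (Subtype.val ∘ γ) '' Icc 0 D ⊆ J) {t₀ : ℝ} (ht₀ : t₀ ∈ Ioo 0 D)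
    (o : EuclideanSpace ℝ (Fin 2)) :
    ∃ z ∈ J, dist (γ t₀ : EuclideanSpace ℝ (Fin 2)) o < dist z o := by
  let ι : EuclideanSpace ℝ (Fin 2) ≃ₗᵢ[ℝ] ℂ := Complex.orthonormalBasisOneI.repr.symm
  obtain ⟨φ, hφ, hφi, rfl⟩ := hJ
  have hιJ : IsSimpleClosedCurve (ι '' range φ) :=
    ⟨ι ∘ φ, ι.continuous.comp hφ, ι.injective.comp hφi, range_comp _ _⟩
  have hgeo : ∀ s ∈ Icc 0 D, ∀ t ∈ Icc 0 D,
      segment ℝ (ι (γ s)) (ι (γ t)) ⊆ ι '' E → |s - t| ≤ dist (ι (γ s)) (ι (γ t)) := by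
    intro s hs t ht hseg
    have h1 : segment ℝ (γ s : EuclideanSpace ℝ (Fin 2)) (γ t) ⊆ E := by
      intro w hw
      have hw' : ι w ∈ segment ℝ (ι (γ s)) (ι (γ t)) := by
        have := image_segment ℝ (ι.toLinearEquiv.toLinearMap.toAffineMap) (γ s : _) (γ t : _)
        rw [show segment ℝ (ι (γ s)) (ι (γ t)) = _ from this.symm]
        exact ⟨w, hw, rfl⟩
      obtain ⟨w', hw'E, h⟩ := hseg hw'
      rwa [← ι.injective h]
    have h2 := pathEDist_le_of_segment_subset h1
    rw [hγ.2.2 s hs t ht, edist_dist, ENNReal.ofReal_le_ofReal_iff dist_nonneg] at h2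
    rw [ι.dist_map]
    exact h2
  have hlog : ∀ w, w ∉ ι '' E → HasLogAt (ι '' range φ) w := by
    intro w hw
    have hcontf : Continuous fun e : E => ι e := ι.continuous.comp continuous_subtype_val
    have hψ : Continuous fun p => (⟨φ p, hJE (mem_range_self p)⟩ : E) := hφ.subtype_mk _
    have := hasLogAt_range_of_simplyConnectedSpace hcontf
      (fun e h => hw ⟨e, e.2, h⟩) hψ (ι.injective.comp hφi)
    rwa [← range_comp]
  obtain ⟨_, ⟨z, hz, rfl⟩, hlt⟩ := exists_dist_lt_dist_of_geodesic hιJ (image_mono hJE) hlog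
    (γ := fun t => ι (γ t)) (D := D)
    (fun s hs t ht => by rw [ι.edist_map]; exact hγ.lipschitzOnWith hs ht)
    (fun s hs t ht h => hγ.injOn hs ht (Subtype.ext (ι.injective h)))
    (fun s hs => mem_image_of_mem ι (hmaps (mem_image_of_mem _ hs))) hgeo ht₀ (ι o)
  rw [ι.dist_map, ι.dist_map] at hlt
  exact ⟨z, hz, hlt⟩

/-- A simple geodesic triangle in a closed, simply connected, rectifiably
path-connected subset of the plane is contained in the convex hull of its vertices. -/
theorem triangle_in_convex_hull (E : Set (EuclideanSpace ℝ (Fin 2)))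
    (hclosed : IsClosed E) (hsc : SimplyConnectedSpace E)
    (hrect : ∀ x y : E, pathEDist x y ≠ ⊤)
    (T : SimpleGeodesicTriangle E) :
    T.im ⊆ convexHull ℝ {(T.p : EuclideanSpace ℝ (Fin 2)),
      (T.q : EuclideanSpace ℝ (Fin 2)), (T.r : EuclideanSpace ℝ (Fin 2))} := by
  have hJE : T.im ⊆ E := by
    rintro _ ((⟨t, -, rfl⟩ | ⟨t, -, rfl⟩) | ⟨t, -, rfl⟩) <;> exact Subtype.coe_prop _
  have hcompact : IsCompact T.im := by
    obtain ⟨φ, hφ, -, h⟩ := T.simple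
    exact (show range φ = T.im from h) ▸ isCompact_range hφ
  intro z hz
  by_contra hzc
  obtain ⟨o, ho⟩ := exists_forall_dist_lt_of_notMem_convexHull (toFinite _) hzc
  obtain ⟨e, he, hmax⟩ := hcompact.exists_isMaxOn ⟨z, hz⟩
    (f := fun w => dist w o) (by fun_prop)
  have hvert : ∀ v ∈ ({(T.p : EuclideanSpace ℝ (Fin 2)), (T.q : EuclideanSpace ℝ (Fin 2)),
      (T.r : EuclideanSpace ℝ (Fin 2))} : Set _), e ≠ v := by
    rintro v hv rfl
    exact absurd (hmax hz) (not_le.2 (ho _ hv))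
  have hedge : ∀ {γ : ℝ → E} {D : ℝ} {x y : E}, IsGeodesicSegment γ D x y →
      (Subtype.val ∘ γ) '' Icc 0 D ⊆ T.im → e ≠ x → e ≠ y →
      e ∉ (Subtype.val ∘ γ) '' Icc 0 D := by
    rintro γ D x y hγ hsub hx hy ⟨t, ht, rfl⟩
    have h0 : t ≠ 0 := by rintro rfl; exact hx (congrArg Subtype.val hγ.1)
    have hD : t ≠ D := by rintro rfl; exact hy (congrArg Subtype.val hγ.2.1)
    obtain ⟨w, hw, hlt⟩ := hγ.exists_dist_lt_dist T.simple hJE hsub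
      ⟨ht.1.lt_of_ne h0.symm, ht.2.lt_of_ne hD⟩ o
    exact absurd (hmax hw) (not_le.2 hlt)
  rcases he with (he | he) | he
  · exact hedge T.hσ (fun w hw => Or.inl (Or.inl hw)) (hvert _ (by simp)) (hvert _ (by simp)) he
  · exact hedge T.hτ (fun w hw => Or.inl (Or.inr hw)) (hvert _ (by simp)) (hvert _ (by simp)) he
  · exact hedge T.hρ (fun w hw => Or.inr hw) (hvert _ (by simp)) (hvert _ (by simp)) he
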